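/- Let n ≥ 1 and let Γ be an n-dimensional crystallographic group, and let T be the subgroup of pure translations in Γ. Then T is the unique maximal abelian subgroup of finite index in Γ: T is abelian of finite index in Γ, and every abelian subgroup of Γ of finite index in Γ is contained in T. -/

import Mathlib

open Matrix

noncomputable section

/-- The topology on the isometry group of Euclidean `n`-space, induced from
the topology of pointwise convergence on maps. -/
instance euclideanIsometryGroupTopology (n : ℕ) :
    TopologicalSpace (EuclideanSpace ℝ (Fin n) ≃ᵢ EuclideanSpace ℝ (Fin n)) :=
  TopologicalSpace.induced
    (fun f => (f : EuclideanSpace ℝ (Fin n) → EuclideanSpace ℝ (Fin n))) inferInstance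

/-- The natural action of the isometry group on Euclidean `n`-space. -/
instance euclideanIsometryGroupAction (n : ℕ) :
    MulAction (EuclideanSpace ℝ (Fin n) ≃ᵢ EuclideanSpace ℝ (Fin n))
      (EuclideanSpace ℝ (Fin n)) where
  smul f x := f x
  one_smul _ := rfl
  mul_smul _ _ _ := rfl

/-- A subgroup of the isometry group of Euclidean `n`-space is crystallographic if it is
discrete and acts cocompactly (the orbit-space quotient is compact). -/
def IsCrystallographic {n : ℕ}
    (Γ : Subgroup (EuclideanSpace ℝ (Fin n) ≃ᵢ EuclideanSpace ℝ (Fin n))) : Prop :=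
  DiscreteTopology Γ ∧
    CompactSpace (MulAction.orbitRel.Quotient Γ (EuclideanSpace ℝ (Fin n)))

/-- The subgroup of pure translations of Euclidean `n`-space: isometries of the form
`x ↦ x + t`. -/
def translationSubgroup (n : ℕ) :
    Subgroup (EuclideanSpace ℝ (Fin n) ≃ᵢ EuclideanSpace ℝ (Fin n)) where
  carrier := {f | ∃ t, ∀ x, f x = x + t}
  one_mem' := ⟨0, fun x => by simp⟩
  mul_mem' := by
    rintro f g ⟨t, ht⟩ ⟨s, hs⟩
    exact ⟨s + t, fun x => by
      show f (g x) = x + (s + t)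
      rw [hs, ht, add_assoc]⟩
  inv_mem' := by
    rintro f ⟨t, ht⟩
    refine ⟨-t, fun x => ?_⟩
    show f.symm x = x + -t
    rw [f.symm_apply_eq, ht]
    abel

end

section Bieberbach

open Filter Topology
open scoped commutatorElement

variable {E : Type*} [NormedAddCommGroup E] [InnerProductSpace ℝ E]

/-- The linear part of an isometry of a real inner product space. -/
noncomputable def linearPart : (E ≃ᵢ E) →* (E ≃ₗᵢ[ℝ] E) where
  toFun f := f.toRealAffineIsometryEquiv.linearIsometryEquiv
  map_one' := by
    ext v
    have := (1 : E ≃ᵢ E).toRealAffineIsometryEquiv.map_vadd 0 v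
    simpa using this.symm
  map_mul' f g := by
    ext v
    have h1 := (f * g).toRealAffineIsometryEquiv.map_vadd 0 v
    have h2 := g.toRealAffineIsometryEquiv.map_vadd 0 v
    have h3 := f.toRealAffineIsometryEquiv.map_vadd (g 0)
      (g.toRealAffineIsometryEquiv.linearIsometryEquiv v)
    simp only [vadd_eq_add, add_zero, IsometryEquiv.coeFn_toRealAffineIsometryEquiv,
      IsometryEquiv.mul_apply] at h1 h2 h3
    rw [h2, h3] at h1
    exact (add_right_cancel h1).symm

theorem apply_add_eq_linearPart (f : E ≃ᵢ E) (v p : E) : f (v + p) = linearPart f v + f p := by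
  exact f.toRealAffineIsometryEquiv.map_vadd p v

theorem apply_eq_linearPart (f : E ≃ᵢ E) (x p : E) : f x = linearPart f (x - p) + f p := by
  rw [← apply_add_eq_linearPart, sub_add_cancel]

/-- `A` moves every vector by at most `c` times its norm. -/
def NearIdentity (c : ℝ) (A : E ≃ₗᵢ[ℝ] E) : Prop :=
  ∀ v, ‖A v - v‖ ≤ c * ‖v‖

theorem nearIdentity_two (A : E ≃ₗᵢ[ℝ] E) : NearIdentity 2 A := fun v => by
  have := norm_sub_le (A v) v
  rw [A.norm_map] at this
  linarith

theorem NearIdentity.commutator {c d : ℝ} {A B : E ≃ₗᵢ[ℝ] E} (hc : 0 ≤ c) (hd : 0 ≤ d)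
    (hA : NearIdentity c A) (hB : NearIdentity d B) : NearIdentity (2 * c * d) ⁅A, B⁆ := by
  intro v
  obtain ⟨w, rfl⟩ : ∃ w, v = B (A w) := ⟨A⁻¹ (B⁻¹ v), by simp⟩
  have h : ⁅A, B⁆ (B (A w)) - B (A w) =
      (A (B w - w) - (B w - w)) - (B (A w - w) - (A w - w)) := by
    have : ⁅A, B⁆ (B (A w)) = A (B w) := by
      simp [commutatorElement_def]
    rw [this, map_sub, map_sub]
    abel
  rw [h, B.norm_map, A.norm_map]
  have h1 := (hA (B w - w)).trans (mul_le_mul_of_nonneg_left (hB w) hc)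
  have h2 := (hB (A w - w)).trans (mul_le_mul_of_nonneg_left (hA w) hd)
  have h3 := norm_sub_le (A (B w - w) - (B w - w)) (B (A w - w) - (A w - w))
  linarith

/-- An isometry all of whose powers are close to the identity is the identity. -/
theorem eq_one_of_forall_pow_nearIdentity {D : E ≃ₗᵢ[ℝ] E}
    (h : ∀ m : ℕ, NearIdentity (1 / 2) (D ^ m)) : D = 1 := by
  ext w
  set v := D w - w with hv
  have hsum : ∀ N : ℕ, ‖(N : ℝ) • v - ((D ^ N) w - w)‖ ≤ N * (1 / 2 * ‖v‖) := by
    intro N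
    induction N with
    | zero => simp
    | succ N ih =>
      have hstep : ((N + 1 : ℕ) : ℝ) • v - ((D ^ (N + 1)) w - w) =
          ((N : ℝ) • v - ((D ^ N) w - w)) - ((D ^ N) v - v) := by
        rw [pow_succ, LinearIsometryEquiv.coe_mul, Function.comp_apply, hv, map_sub]
        push_cast
        module
      rw [hstep]
      refine (norm_sub_le _ _).trans ?_
      have := h N v
      push_cast
      linarith
  have hb : ∀ N : ℕ, (N : ℝ) * ‖v‖ ≤ 4 * ‖w‖ := by
    intro N
    have h1 := hsum N
    have h2 := norm_sub_norm_le ((N : ℝ) • v) ((D ^ N) w - w)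
    have h3 := norm_sub_le ((D ^ N) w) w
    rw [(D ^ N).norm_map] at h3
    rw [norm_smul, Real.norm_natCast] at h2
    linarith
  have hv0 : v = 0 := by
    by_contra hne
    have hpos : 0 < ‖v‖ := norm_pos_iff.mpr hne
    obtain ⟨N, hN⟩ := exists_nat_gt (4 * ‖w‖ / ‖v‖)
    rw [div_lt_iff₀ hpos] at hN
    exact absurd (hb N) (not_le.mpr hN)
  simpa [hv, sub_eq_zero] using hv0

theorem pow_mul_eq_commutator_pow_mul {G : Type*} [Group G] {a b : G} (h : Commute a ⁅a, b⁆)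
    (m : ℕ) : a ^ m * b = ⁅a, b⁆ ^ m * b * a ^ m := by
  induction m with
  | zero => simp
  | succ m ih =>
    have h1 : a * b = ⁅a, b⁆ * b * a := by simp [commutatorElement_def]
    have h2 : a * ⁅a, b⁆ ^ m = ⁅a, b⁆ ^ m * a := (h.pow_right m).eq
    calc a ^ (m + 1) * b = a * (a ^ m * b) := by rw [pow_succ', mul_assoc]
      _ = a * ⁅a, b⁆ ^ m * b * a ^ m := by rw [ih]; simp only [mul_assoc]
      _ = ⁅a, b⁆ ^ m * (a * b) * a ^ m := by rw [h2]; simp only [mul_assoc]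
      _ = ⁅a, b⁆ ^ (m + 1) * b * a ^ (m + 1) := by
        rw [h1, pow_succ, pow_succ']; simp only [mul_assoc]

theorem commutator_eq_one_of_commute {A B : E ≃ₗᵢ[ℝ] E} (hB : NearIdentity (1 / 8) B)
    (h : Commute A ⁅A, B⁆) : ⁅A, B⁆ = 1 := by
  apply eq_one_of_forall_pow_nearIdentity
  intro m v
  obtain ⟨w, rfl⟩ : ∃ w, v = B ((A ^ m) w) :=
    ⟨(A ^ m)⁻¹ (B⁻¹ v), by simp⟩
  have h1 : (⁅A, B⁆ ^ m) (B ((A ^ m) w)) = (A ^ m) (B w) := by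
    exact (DFunLike.congr_fun (pow_mul_eq_commutator_pow_mul h m) w).symm
  have h2 : (A ^ m) (B w) - B ((A ^ m) w) =
      (A ^ m) (B w - w) - (B ((A ^ m) w) - (A ^ m) w) := by
    rw [map_sub]; abel
  rw [h1, h2, B.norm_map]
  have h3 := norm_sub_le ((A ^ m) (B w - w)) (B ((A ^ m) w) - (A ^ m) w)
  have h4 := hB w
  have h5 := hB ((A ^ m) w)
  rw [(A ^ m).norm_map] at h3 h5
  rw [(A ^ m).norm_map]
  linarith [norm_nonneg w]

/-- A fixed vector of an isometry `A` in the range of `A - 1` vanishes. -/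
theorem sub_eq_zero_of_map_sub_eq {A : E ≃ₗᵢ[ℝ] E} {x : E} (h : A (A x - x) = A x - x) :
    A x - x = 0 := by
  have h1 : inner ℝ (A x - x) (A x) = inner ℝ (A x - x) x := by
    conv_lhs => rw [← h]
    exact A.inner_map_map _ _
  rw [← inner_self_eq_zero (𝕜 := ℝ), inner_sub_right, h1, sub_self]

/-- Every isometry of a finite-dimensional space moves some point by a vector
fixed by its linear part. -/
theorem exists_linearPart_apply_sub_self_eq [FiniteDimensional ℝ E] (α : E ≃ᵢ E) :
    ∃ p, linearPart α (α p - p) = α p - p := by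
  set A := linearPart α with hA
  let S : E →ₗ[ℝ] E := A.toLinearEquiv.toLinearMap - LinearMap.id
  have hS : ∀ x, S x = A x - x := fun x => rfl
  have hdisj : Disjoint (LinearMap.ker S) (LinearMap.range S) := by
    rw [Submodule.disjoint_def]
    rintro _ hk ⟨x, rfl⟩
    rw [LinearMap.mem_ker, hS, sub_eq_zero] at hk
    exact sub_eq_zero_of_map_sub_eq hk
  have hcompl : IsCompl (LinearMap.ker S) (LinearMap.range S) := by
    refine (Submodule.isCompl_iff_disjoint _ _ ?_).mpr hdisj
    rw [add_comm, LinearMap.finrank_range_add_finrank_ker]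
  obtain ⟨k, hk, _, ⟨q, rfl⟩, hkq⟩ := Submodule.mem_sup.mp
    (hcompl.sup_eq_top ▸ Submodule.mem_top : α 0 ∈ LinearMap.ker S ⊔ LinearMap.range S)
  refine ⟨-q, ?_⟩
  have h1 : α (-q) - -q = k := by
    rw [apply_eq_linearPart α (-q) 0, ← hkq, hS, sub_zero, map_neg]
    abel
  rw [h1]
  rwa [LinearMap.mem_ker, hS, sub_eq_zero] at hk

theorem commutator_apply_sub_self (α β : E ≃ᵢ E) (p e f : E)
    (he : α p - p = linearPart α e) (hf : β p - p = linearPart β (linearPart α f)) :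
    ⁅α, β⁆ p - p = linearPart α (linearPart β (linearPart α f - f)) -
      linearPart α (linearPart β e - e) := by
  have hx : β (α (p - f - e)) = p := by
    rw [apply_eq_linearPart α _ p, sub_eq_iff_eq_add.mp he, apply_eq_linearPart β _ p,
      sub_eq_iff_eq_add.mp hf]
    simp only [map_sub, map_add]
    abel
  have hc : ⁅α, β⁆ p = α (β (p - f - e)) := by
    conv_lhs => rw [← hx]
    change (⁅α, β⁆ * β * α) (p - f - e) = (α * β) (p - f - e)
    congr 1
    simp [commutatorElement_def]
  rw [hc, apply_eq_linearPart β _ p, sub_eq_iff_eq_add.mp hf, apply_eq_linearPart α _ p,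
    sub_eq_iff_eq_add.mp he]
  simp only [map_sub, map_add]
  abel

theorem norm_commutator_apply_sub_self_le {α β : E ≃ᵢ E} {c d : ℝ}
    (hα : NearIdentity c (linearPart α)) (hβ : NearIdentity d (linearPart β)) (p : E) :
    ‖⁅α, β⁆ p - p‖ ≤ c * ‖β p - p‖ + d * ‖α p - p‖ := by
  obtain ⟨e, he⟩ := (linearPart α).surjective (α p - p)
  obtain ⟨f', hf'⟩ := (linearPart β).surjective (β p - p)
  obtain ⟨f, rfl⟩ := (linearPart α).surjective f'
  rw [commutator_apply_sub_self α β p e f he.symm hf'.symm]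
  refine (norm_sub_le _ _).trans ?_
  rw [← he, ← hf']
  simp only [LinearIsometryEquiv.norm_map]
  exact add_le_add (hα f) (hβ e)

/-- The sequence of iterated commutators `b, ⁅a, b⁆, ⁅a, ⁅a, b⁆⁆, …`. -/
def iteratedCommutator {G : Type*} [Group G] (a b : G) : ℕ → G
  | 0 => b
  | k + 1 => ⁅a, iteratedCommutator a b k⁆

theorem iteratedCommutator_mem {G : Type*} [Group G] {H : Subgroup G} {a b : G}
    (ha : a ∈ H) (hb : b ∈ H) (k : ℕ) : iteratedCommutator a b k ∈ H := by
  induction k with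
  | zero => exact hb
  | succ k ih => exact H.mul_mem (H.mul_mem (H.mul_mem ha ih) (H.inv_mem ha)) (H.inv_mem ih)

theorem nearIdentity_iteratedCommutator {c : ℝ} (hc : 0 ≤ c) {α β : E ≃ᵢ E}
    (hα : NearIdentity (1 / 8) (linearPart α)) (hβ : NearIdentity c (linearPart β)) (k : ℕ) :
    NearIdentity (c * (1 / 4) ^ k) (linearPart (iteratedCommutator α β k)) := by
  induction k with
  | zero => simpa [iteratedCommutator] using hβ
  | succ k ih =>
    have h := hα.commutator (by norm_num) (by positivity) ih
    rw [iteratedCommutator, map_commutatorElement]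
    convert h using 1
    ring

theorem tendsto_iteratedCommutator_apply {α : E ≃ᵢ E}
    (hα : NearIdentity (1 / 8) (linearPart α)) (β : E ≃ᵢ E) (x : E) :
    Tendsto (fun k => iteratedCommutator α β k x) atTop (𝓝 x) := by
  have hnear := nearIdentity_iteratedCommutator zero_le_two hα (nearIdentity_two (linearPart β))
  have hbound : ∀ k, ‖iteratedCommutator α β k x - x‖ + 16 * ‖α x - x‖ * (1 / 4) ^ k ≤
      (‖β x - x‖ + 16 * ‖α x - x‖) * (1 / 2) ^ k := by
    intro k
    induction k with
    | zero => simp [iteratedCommutator]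
    | succ k ih =>
      have h := norm_commutator_apply_sub_self_le hα (hnear k) x
      have h0 : 0 ≤ ‖α x - x‖ * (1 / 4) ^ k := by positivity
      have h1 := norm_nonneg (iteratedCommutator α β k x - x)
      rw [iteratedCommutator, pow_succ, pow_succ]
      linarith
  rw [tendsto_iff_norm_sub_tendsto_zero]
  refine squeeze_zero (fun _ => norm_nonneg _)
    (fun k => le_trans (le_add_of_nonneg_right (by positivity)) (hbound k)) ?_
  simpa using (tendsto_pow_atTop_nhds_zero_of_lt_one (r := (1 / 2 : ℝ))
    (by norm_num) (by norm_num)).const_mul (‖β x - x‖ + 16 * ‖α x - x‖)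

/-- A sequential form of discreteness at the identity: a sequence in `Γ` converging pointwise
to the identity is eventually equal to it. -/
def SeqDiscrete (Γ : Subgroup (E ≃ᵢ E)) : Prop :=
  ∀ f : ℕ → E ≃ᵢ E, (∀ k, f k ∈ Γ) → (∀ x, Tendsto (fun k => f k x) atTop (𝓝 x)) →
    ∀ᶠ k in atTop, f k = 1

/-- Some orbit of `Γ` is `d`-dense. -/
def HasDenseOrbit (Γ : Subgroup (E ≃ᵢ E)) : Prop :=
  ∃ d : ℝ, ∀ x : E, ∃ γ ∈ Γ, ‖γ 0 - x‖ ≤ d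

theorem SeqDiscrete.commutator_linearPart_eq_one {Γ : Subgroup (E ≃ᵢ E)} (hΓ : SeqDiscrete Γ)
    {α β : E ≃ᵢ E} (hαΓ : α ∈ Γ) (hβΓ : β ∈ Γ) (hα : NearIdentity (1 / 8) (linearPart α))
    (hβ : NearIdentity (1 / 8) (linearPart β)) : ⁅linearPart α, linearPart β⁆ = 1 := by
  have hev := hΓ _ (iteratedCommutator_mem hαΓ hβΓ) (tendsto_iteratedCommutator_apply hα β)
  obtain ⟨N, hN⟩ := hev.exists
  have hnear : ∀ k, NearIdentity (1 / 8) (linearPart (iteratedCommutator α β k)) := by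
    intro k v
    refine (nearIdentity_iteratedCommutator (by norm_num) hα hβ k v).trans ?_
    gcongr
    exact mul_le_of_le_one_right (by norm_num) (pow_le_one₀ (by norm_num) (by norm_num))
  have hcomm : ∀ k, ⁅linearPart α, linearPart (iteratedCommutator α β k)⁆ = 1 →
      ⁅linearPart α, linearPart β⁆ = 1 := by
    intro k
    induction k with
    | zero => exact id
    | succ k ih =>
      intro h
      rw [iteratedCommutator, map_commutatorElement] at h
      exact ih (commutator_eq_one_of_commute (hnear k) (commutatorElement_eq_one_iff_commute.mp h))
  exact hcomm N (by rw [hN]; simp)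

/-- If the linear parts of `α` and `β` are close to the identity and the displacement of `p` by `α`
is fixed by the linear part of `α`, then so is the displacement of `p` by `β`. -/
theorem SeqDiscrete.linearPart_apply_sub_self_eq {Γ : Subgroup (E ≃ᵢ E)} (hΓ : SeqDiscrete Γ)
    {α β : E ≃ᵢ E} (hαΓ : α ∈ Γ) (hβΓ : β ∈ Γ) (hα : NearIdentity (1 / 8) (linearPart α))
    (hβ : NearIdentity (1 / 8) (linearPart β)) {p : E}
    (hp : linearPart α (α p - p) = α p - p) : linearPart α (β p - p) = β p - p := by
  set A := linearPart α with hA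
  have hAB := hΓ.commutator_linearPart_eq_one hαΓ hβΓ hα hβ
  have hswap : ∀ v, A (linearPart β v) = linearPart β (A v) := fun v =>
    DFunLike.congr_fun (commutatorElement_eq_one_iff_mul_comm.mp hAB) v
  have hlin : ∀ k, linearPart (iteratedCommutator α β (k + 1)) = 1 := by
    intro k
    induction k with
    | zero => rw [iteratedCommutator, map_commutatorElement]; exact hAB
    | succ k ih => rw [iteratedCommutator, map_commutatorElement, ih, commutatorElement_one_right]
  -- displacements of a commutator with `α` of an isometry whose linear part commutes with `A`
  have hdisp : ∀ γ : E ≃ᵢ E, (∀ v, A (linearPart γ v) = linearPart γ (A v)) →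
      ⁅α, γ⁆ p - p = (A (γ p - p) - (γ p - p)) - (linearPart γ (α p - p) - (α p - p)) := by
    intro γ hγ
    obtain ⟨f', hf'⟩ := (linearPart γ).surjective (γ p - p)
    obtain ⟨f, rfl⟩ := A.surjective f'
    rw [commutator_apply_sub_self α γ p (α p - p) f hp.symm hf'.symm, ← hf', map_sub, map_sub,
      map_sub, ← hA, hγ f, hγ (α p - p), hp]
  have hev := hΓ _ (iteratedCommutator_mem hαΓ hβΓ) (tendsto_iteratedCommutator_apply hα β)
  obtain ⟨N, hN⟩ := eventually_atTop.mp hev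
  have hdesc : ∀ k, A (iteratedCommutator α β (k + 1) p - p) =
      iteratedCommutator α β (k + 1) p - p → A (⁅α, β⁆ p - p) = ⁅α, β⁆ p - p := by
    intro k
    induction k with
    | zero => exact id
    | succ k ih =>
      intro h
      apply ih
      have h1 := hdisp (iteratedCommutator α β (k + 1)) (by simp [hlin k])
      rw [hlin k, LinearIsometryEquiv.coe_one, id, sub_self, sub_zero] at h1
      rw [iteratedCommutator, h1] at h
      exact sub_eq_zero.mp (sub_eq_zero_of_map_sub_eq h)
  have hfix := hdesc N (by rw [hN (N + 1) (by lia)]; simp)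
  have h2 := hdisp β hswap
  refine sub_eq_zero.mp (sub_eq_zero_of_map_sub_eq ?_)
  have h3 : A (β p - p) - (β p - p) =
      (⁅α, β⁆ p - p) + (linearPart β (α p - p) - (α p - p)) := by rw [h2]; abel
  rw [h3, map_add, hfix, map_sub, hswap, hp]

/-- An isometry displacing the points of an orbit that is coarsely dense by a bounded amount
is the identity. -/
theorem HasDenseOrbit.eq_one_of_bounded {Γ : Subgroup (E ≃ᵢ E)} (hΓ : HasDenseOrbit Γ)
    {A : E ≃ₗᵢ[ℝ] E} {M : ℝ} (h : ∀ γ ∈ Γ, ‖A (γ 0) - γ 0‖ ≤ M) : A = 1 := by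
  obtain ⟨d, hd⟩ := hΓ
  have hbound : ∀ x, ‖A x - x‖ ≤ M + 2 * d := by
    intro x
    obtain ⟨γ, hγ, hx⟩ := hd x
    have h1 : A x - x = (A (γ 0) - γ 0) - (A (γ 0 - x) - (γ 0 - x)) := by
      rw [map_sub]; abel
    have h2 := norm_sub_le (A (γ 0) - γ 0) (A (γ 0 - x) - (γ 0 - x))
    rw [h1]
    linarith [h γ hγ, nearIdentity_two A (γ 0 - x)]
  ext v
  by_contra hne
  have hpos : 0 < ‖A v - v‖ := norm_pos_iff.mpr (sub_ne_zero.mpr hne)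
  obtain ⟨N, hN⟩ := exists_nat_gt ((M + 2 * d) / ‖A v - v‖)
  rw [div_lt_iff₀ hpos] at hN
  have h1 := hbound ((N : ℝ) • v)
  rw [map_smul, ← smul_sub, norm_smul, Real.norm_natCast] at h1
  linarith

/-- Modulo finitely many elements, every element of `Γ` has linear part near the identity. -/
theorem exists_finite_nearIdentity_mul_inv [FiniteDimensional ℝ E] (Γ : Subgroup (E ≃ᵢ E)) {c : ℝ}
    (hc : 0 < c) : ∃ t : Set (E ≃ᵢ E), t.Finite ∧ t ⊆ Γ ∧
      ∀ γ ∈ Γ, ∃ g ∈ t, NearIdentity c (linearPart (γ * g⁻¹)) := by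
  let φ : (E ≃ᵢ E) → E →L[ℝ] E := fun γ => (linearPart γ).toContinuousLinearEquiv
  have hφ : ∀ γ v, φ γ v = linearPart γ v := fun _ _ => rfl
  have htb : TotallyBounded (φ '' Γ) := by
    refine TotallyBounded.subset ?_
      (ProperSpace.isCompact_closedBall (0 : E →L[ℝ] E) 1).totallyBounded
    rintro _ ⟨γ, -, rfl⟩
    rw [mem_closedBall_zero_iff]
    exact ContinuousLinearMap.opNorm_le_bound _ zero_le_one fun v => by
      rw [hφ, LinearIsometryEquiv.norm_map, one_mul]
  obtain ⟨s, hsub, hfin, hcover⟩ := Metric.finite_approx_of_totallyBounded htb c hc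
  have hsub' : ∀ y ∈ s, ∃ g ∈ Γ, φ g = y := fun y hy => hsub hy
  choose! ψ hψΓ hψ using hsub'
  refine ⟨ψ '' s, hfin.image ψ, Set.image_subset_iff.mpr fun y hy => hψΓ y hy, fun γ hγ => ?_⟩
  obtain ⟨y, hy, hγy⟩ := Set.mem_iUnion₂.mp (hcover ⟨γ, hγ, rfl⟩)
  refine ⟨ψ y, ⟨y, hy, rfl⟩, fun v => ?_⟩
  obtain ⟨w, rfl⟩ := (linearPart (ψ y)).surjective v
  have h1 : linearPart (γ * (ψ y)⁻¹) (linearPart (ψ y) w) - linearPart (ψ y) w =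
      (φ γ - φ (ψ y)) w := by
    simp [hφ]
  rw [Metric.mem_ball, ← hψ y hy, dist_eq_norm] at hγy
  rw [h1, LinearIsometryEquiv.norm_map]
  exact (ContinuousLinearMap.le_opNorm _ w).trans (by gcongr)

/-- Elements of `Γ` with linear part near the identity are translations. -/
theorem SeqDiscrete.linearPart_eq_one [FiniteDimensional ℝ E] {Γ : Subgroup (E ≃ᵢ E)}
    (hΓ : SeqDiscrete Γ) (hΓ' : HasDenseOrbit Γ) {α : E ≃ᵢ E} (hαΓ : α ∈ Γ)
    (hα : NearIdentity (1 / 8) (linearPart α)) : linearPart α = 1 := by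
  obtain ⟨p, hp⟩ := exists_linearPart_apply_sub_self_eq α
  obtain ⟨t, htfin, htΓ, ht⟩ := exists_finite_nearIdentity_mul_inv Γ (c := 1 / 8) (by norm_num)
  obtain ⟨M, hM⟩ := (htfin.image fun g => ‖g p - p‖).bddAbove
  refine hΓ'.eq_one_of_bounded (M := 2 * (M + 2 * ‖p‖)) fun γ hγ => ?_
  obtain ⟨g, hgt, hg⟩ := ht γ hγ
  set β := γ * g⁻¹ with hβ
  have hβΓ : β ∈ Γ := Γ.mul_mem hγ (Γ.inv_mem (htΓ hgt))
  have hfix := hΓ.linearPart_apply_sub_self_eq hαΓ hβΓ hα hg hp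
  have hγβ : γ 0 = β (g 0) := by rw [hβ]; simp
  have hgM : ‖g p - p‖ ≤ M := hM ⟨g, hgt, rfl⟩
  set w := γ 0 - (β p - p) with hw
  have hwM : ‖w‖ ≤ M + 2 * ‖p‖ := by
    have h1 : w = linearPart β (g 0 - p) + p := by
      rw [hw, hγβ, apply_eq_linearPart β _ p]; abel
    have h2 : g 0 - p = (g p - p) - linearPart g p := by
      rw [apply_eq_linearPart g p 0, sub_zero]; abel
    rw [h1]
    refine (norm_add_le _ _).trans ?_
    rw [LinearIsometryEquiv.norm_map, h2]
    have h3 := norm_sub_le (g p - p) (linearPart g p)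
    rw [LinearIsometryEquiv.norm_map] at h3
    linarith
  have hsplit : linearPart α (γ 0) - γ 0 = linearPart α w - w := by
    rw [hw, map_sub, hfix]; abel
  rw [hsplit]
  linarith [nearIdentity_two (linearPart α) w]

/-- The point group of `Γ` is finite. -/
theorem SeqDiscrete.finite_linearPart_image [FiniteDimensional ℝ E] {Γ : Subgroup (E ≃ᵢ E)}
    (hΓ : SeqDiscrete Γ) (hΓ' : HasDenseOrbit Γ) : (linearPart '' (Γ : Set (E ≃ᵢ E))).Finite := by
  obtain ⟨t, htfin, htΓ, ht⟩ := exists_finite_nearIdentity_mul_inv Γ (c := 1 / 8) (by norm_num)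
  refine (htfin.image linearPart).subset ?_
  rintro _ ⟨γ, hγ, rfl⟩
  obtain ⟨g, hgt, hg⟩ := ht γ hγ
  have h := hΓ.linearPart_eq_one hΓ' (Γ.mul_mem hγ (Γ.inv_mem (htΓ hgt))) hg
  rw [map_mul, map_inv, mul_inv_eq_one] at h
  exact ⟨g, hgt, h.symm⟩

theorem HasDenseOrbit.linearPart_eq_one_of_commute {Γ Δ : Subgroup (E ≃ᵢ E)}
    (hΓ : HasDenseOrbit Γ) [hΔ : (Δ.subgroupOf Γ).FiniteIndex]
    (htrans : ∀ δ ∈ Δ, linearPart δ = 1) {α : E ≃ᵢ E} (hα : ∀ δ ∈ Δ, α * δ = δ * α) :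
    linearPart α = 1 := by
  set A := linearPart α with hA
  have hfix : ∀ δ ∈ Δ, A (δ 0) = δ 0 := by
    intro δ hδ
    have h1 : α (δ 0) = δ (α 0) := DFunLike.congr_fun (hα δ hδ) 0
    rw [apply_eq_linearPart α (δ 0) 0, apply_eq_linearPart δ (α 0) 0, htrans δ hδ] at h1
    simpa [add_comm] using h1
  obtain ⟨M, hM⟩ := (Set.finite_range fun q : Γ ⧸ Δ.subgroupOf Γ =>
    ‖((q.out : Γ) : E ≃ᵢ E)⁻¹ 0‖).bddAbove
  refine hΓ.eq_one_of_bounded (M := 2 * M) fun γ hγ => ?_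
  set g : Γ := Quotient.out (((⟨γ, hγ⟩ : Γ)⁻¹ : Γ) : Γ ⧸ Δ.subgroupOf Γ) with hg
  have hgM : ‖(g : E ≃ᵢ E)⁻¹ 0‖ ≤ M := hM ⟨_, rfl⟩
  have hmem : (γ * g : E ≃ᵢ E) ∈ Δ := by
    have h := QuotientGroup.eq.mp (QuotientGroup.out_eq'
      (((⟨γ, hγ⟩ : Γ)⁻¹ : Γ) : Γ ⧸ Δ.subgroupOf Γ)).symm
    simpa [Subgroup.mem_subgroupOf] using h
  have hγ0 : γ 0 = (g : E ≃ᵢ E)⁻¹ 0 + (γ * g : E ≃ᵢ E) 0 := by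
    have h : γ 0 = (γ * g : E ≃ᵢ E) ((g : E ≃ᵢ E)⁻¹ 0) := by simp
    rw [h, apply_eq_linearPart (γ * g : E ≃ᵢ E) ((g : E ≃ᵢ E)⁻¹ 0) 0, htrans _ hmem]
    simp
  rw [hγ0, map_add, hfix _ hmem, add_sub_add_right_eq_sub]
  linarith [nearIdentity_two A ((g : E ≃ᵢ E)⁻¹ 0)]

theorem mem_translationSubgroup_iff {n : ℕ}
    {f : EuclideanSpace ℝ (Fin n) ≃ᵢ EuclideanSpace ℝ (Fin n)} :
    f ∈ translationSubgroup n ↔ linearPart f = 1 := by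
  constructor
  · rintro ⟨t, ht⟩
    ext1 v
    have h := apply_eq_linearPart f v 0
    rw [ht, ht, zero_add, sub_zero] at h
    exact (add_right_cancel h).symm
  · intro h
    refine ⟨f 0, fun x => ?_⟩
    rw [apply_eq_linearPart f x 0, h]
    simp

theorem IsCrystallographic.seqDiscrete {n : ℕ}
    {Γ : Subgroup (EuclideanSpace ℝ (Fin n) ≃ᵢ EuclideanSpace ℝ (Fin n))}
    (hΓ : IsCrystallographic Γ) : SeqDiscrete Γ := by
  intro f hf hlim
  have := hΓ.1
  have h : Tendsto (fun k => (⟨f k, hf k⟩ : Γ)) atTop (𝓝 1) := by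
    rw [tendsto_subtype_rng, nhds_induced, tendsto_comap_iff, tendsto_pi_nhds]
    exact hlim
  rw [nhds_discrete, tendsto_pure] at h
  filter_upwards [h] with k hk
  exact congrArg Subtype.val hk

theorem IsCrystallographic.hasDenseOrbit {n : ℕ}
    {Γ : Subgroup (EuclideanSpace ℝ (Fin n) ≃ᵢ EuclideanSpace ℝ (Fin n))}
    (hΓ : IsCrystallographic Γ) : HasDenseOrbit Γ := by
  have := hΓ.2
  have : ContinuousConstSMul Γ (EuclideanSpace ℝ (Fin n)) :=
    ⟨fun γ => (γ : EuclideanSpace ℝ (Fin n) ≃ᵢ EuclideanSpace ℝ (Fin n)).continuous⟩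
  let _ := MulAction.orbitRel Γ (EuclideanSpace ℝ (Fin n))
  let π : EuclideanSpace ℝ (Fin n) → MulAction.orbitRel.Quotient Γ (EuclideanSpace ℝ (Fin n)) :=
    Quotient.mk'
  have hopen : ∀ k : ℕ, IsOpen (π '' Metric.ball 0 k) := fun k =>
    isOpenMap_quotient_mk'_mul _ Metric.isOpen_ball
  have hcover : (Set.univ : Set (MulAction.orbitRel.Quotient Γ (EuclideanSpace ℝ (Fin n)))) ⊆
      ⋃ k : ℕ, π '' Metric.ball 0 k := by
    rintro q -
    obtain ⟨x, rfl⟩ := Quotient.exists_rep q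
    obtain ⟨k, hk⟩ := exists_nat_gt ‖x‖
    exact Set.mem_iUnion.mpr ⟨k, x, by simpa using hk, rfl⟩
  have hdir : Directed (· ⊆ ·) fun k : ℕ => π '' Metric.ball 0 k :=
    directed_of_isDirected_le fun i j hij =>
      Set.image_mono (Metric.ball_subset_ball (Nat.cast_le.mpr hij))
  obtain ⟨d, hd⟩ := isCompact_univ.elim_directed_cover _ hopen hcover hdir
  refine ⟨d, fun x => ?_⟩
  obtain ⟨y, hy, hyx⟩ := hd (Set.mem_univ (π x))
  obtain ⟨γ, hγ⟩ : ∃ γ : Γ, γ • y = x := Quotient.exact hyx.symm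
  refine ⟨γ, γ.2, ?_⟩
  rw [← hγ]
  change ‖γ.1 0 - γ.1 y‖ ≤ d
  rw [← dist_eq_norm, γ.1.dist_eq, dist_comm]
  exact (Metric.mem_ball.mp hy).le

end Bieberbach

/-- **Theorem 2.2** (Long–Reid): in an `n`-dimensional crystallographic group `Γ`, the subgroup
`T` of pure translations in `Γ` is the unique maximal abelian subgroup of finite index: `T` is
abelian of finite index in `Γ`, and every abelian subgroup of `Γ` of finite index in `Γ` is
contained in `T`. -/
theorem crystallographic_translations_maximal_abelian (n : ℕ) (hn : 1 ≤ n)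
    (Γ : Subgroup (EuclideanSpace ℝ (Fin n) ≃ᵢ EuclideanSpace ℝ (Fin n)))
    (hΓ : IsCrystallographic Γ) :
    (∀ a ∈ translationSubgroup n ⊓ Γ, ∀ b ∈ translationSubgroup n ⊓ Γ, a * b = b * a) ∧
      ((translationSubgroup n ⊓ Γ).subgroupOf Γ).FiniteIndex ∧
      ∀ A : Subgroup (EuclideanSpace ℝ (Fin n) ≃ᵢ EuclideanSpace ℝ (Fin n)),
        A ≤ Γ → (∀ a ∈ A, ∀ b ∈ A, a * b = b * a) → (A.subgroupOf Γ).FiniteIndex →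
          A ≤ translationSubgroup n ⊓ Γ := by
  have hdisc := hΓ.seqDiscrete
  have hdense := hΓ.hasDenseOrbit
  have hfin : ((translationSubgroup n ⊓ Γ).subgroupOf Γ).FiniteIndex := by
    have hker : (translationSubgroup n ⊓ Γ).subgroupOf Γ = (linearPart.comp Γ.subtype).ker := by
      ext γ
      simp [Subgroup.mem_subgroupOf, MonoidHom.mem_ker, mem_translationSubgroup_iff]
    have : Finite (linearPart.comp Γ.subtype).range := by
      refine ((hdisc.finite_linearPart_image hdense).subset ?_).to_subtype
      rintro _ ⟨γ, rfl⟩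
      exact ⟨γ, γ.2, rfl⟩
    rw [hker]
    infer_instance
  refine ⟨?_, hfin, ?_⟩
  · rintro a ⟨⟨s, hs⟩, -⟩ b ⟨⟨t, ht⟩, -⟩
    ext1 x
    change a (b x) = b (a x)
    rw [hs, ht, hs, ht, add_right_comm]
  · intro A hAΓ hcomm hA a ha
    refine ⟨mem_translationSubgroup_iff.mpr ?_, hAΓ ha⟩
    have : ((A ⊓ (translationSubgroup n ⊓ Γ)).subgroupOf Γ).FiniteIndex := by
      rw [Subgroup.subgroupOf, Subgroup.comap_inf]
      exact inferInstanceAs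
        (A.subgroupOf Γ ⊓ (translationSubgroup n ⊓ Γ).subgroupOf Γ).FiniteIndex
    exact hdense.linearPart_eq_one_of_commute (Δ := A ⊓ (translationSubgroup n ⊓ Γ))
      (fun δ hδ => mem_translationSubgroup_iff.mp hδ.2.1) fun δ hδ => hcomm a ha δ hδ.1
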